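/- arXiv:2204.12548 — 2 statements merged into one kernel-verified Lean document; each statement's English description precedes it below -/
import Mathlib

section
/- Fix real numbers s > σ > 0 and β ∈ ℝ. There exist constants 0 < c ≤ C, depending only on s, σ, β, such that for every κ ≥ 1 and every Schwartz function q : ℝ → ℂ one has c · κ^{2β} ‖q‖²_{E^{σ+β}_{σ,κ}} ≤ ∫_{κ}^{∞} ‖q‖²_{E^{σ+β}_{s,ϰ}} · ϰ^{2β} dϰ/ϰ ≤ C · κ^{2β} ‖q‖²_{E^{σ+β}_{σ,κ}}. -/
open MeasureTheory

/-- The Fourier transform, normalized by `q̂(ξ) = (2π)^{-1/2} ∫ e^{-iξx} q(x) dx`. -/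
noncomputable def fhat (f : ℝ → ℂ) (ξ : ℝ) : ℂ :=
  ((Real.sqrt (2 * Real.pi) : ℂ))⁻¹
    * ∫ x : ℝ, Complex.exp (-(Complex.I * (ξ : ℂ) * (x : ℂ))) * f x

/-- The squared `E^{σ'}_{s,ϰ}` norm:
`‖q‖²_{E^{σ'}_{s,ϰ}} = ∫ ϰ^{2(s-σ')} |ξ|^{2σ'} (4ϰ²+ξ²)^{-s} |q̂(ξ)|² dξ`. -/
noncomputable def Esq (s σ' ϰ : ℝ) (q : ℝ → ℂ) : ℝ :=
  ∫ ξ : ℝ, ϰ ^ (2 * (s - σ')) * |ξ| ^ (2 * σ') * (4 * ϰ ^ 2 + ξ ^ 2) ^ (-s)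
    * ‖fhat q ξ‖ ^ 2

open Set

lemma measurable_fhat {f : ℝ → ℂ} (hf : Measurable f) : Measurable (fhat f) := by
  unfold fhat
  refine Measurable.const_mul ?_ _
  have h : StronglyMeasurable (Function.uncurry fun ξ x : ℝ =>
      Complex.exp (-(Complex.I * (ξ : ℂ) * (x : ℂ))) * f x) := by
    refine Measurable.stronglyMeasurable ?_
    simp only [Function.uncurry_def]
    fun_prop
  exact (h.integral_prod_right (ν := volume)).measurable

/-- The `ϰ`-dependent part of the weight of `E^{σ+β}_{s,ϰ}`, multiplied by `ϰ^{2β-1}`. -/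
noncomputable def equiKernel (s σ ϰ ξ : ℝ) : ℝ :=
  ϰ ^ (2 * (s - σ) - 1) * (4 * ϰ ^ 2 + ξ ^ 2) ^ (-s)

lemma measurable_equiKernel (s σ : ℝ) :
    Measurable fun p : ℝ × ℝ => equiKernel s σ p.1 p.2 := by
  unfold equiKernel
  fun_prop

lemma equiKernel_nonneg {s σ ϰ ξ : ℝ} (hϰ : 0 ≤ ϰ) : 0 ≤ equiKernel s σ ϰ ξ := by
  unfold equiKernel
  positivity

lemma equiKernel_le_of_le {s σ κ ϰ ξ : ℝ} (hs : 0 ≤ s) (hκ : 0 < κ) (h : κ ≤ ϰ) :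
    equiKernel s σ ϰ ξ ≤ (4 * κ ^ 2 + ξ ^ 2) ^ (-s) * ϰ ^ (2 * (s - σ) - 1) := by
  have hϰ : 0 < ϰ := hκ.trans_le h
  unfold equiKernel
  rw [mul_comm]
  refine mul_le_mul_of_nonneg_right ?_ (by positivity)
  exact Real.rpow_le_rpow_of_nonpos (by positivity) (by gcongr) (by linarith)

lemma mul_sq_rpow_mul_rpow {a s σ ϰ : ℝ} (ha : 0 ≤ a) (hϰ : 0 < ϰ) :
    ϰ ^ (2 * (s - σ) - 1) * (a * ϰ ^ 2) ^ (-s) = a ^ (-s) * ϰ ^ (-(2 * σ) - 1) := by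
  rw [Real.mul_rpow ha (by positivity), ← Real.rpow_natCast ϰ 2, ← Real.rpow_mul hϰ.le,
    mul_left_comm, ← Real.rpow_add hϰ]
  congr 2
  push_cast
  ring

lemma equiKernel_le_rpow {s σ ϰ ξ : ℝ} (hs : 0 ≤ s) (hϰ : 0 < ϰ) :
    equiKernel s σ ϰ ξ ≤ 4 ^ (-s) * ϰ ^ (-(2 * σ) - 1) := by
  rw [← mul_sq_rpow_mul_rpow (by norm_num) hϰ]
  unfold equiKernel
  refine mul_le_mul_of_nonneg_left ?_ (by positivity)
  exact Real.rpow_le_rpow_of_nonpos (by positivity) (by nlinarith [sq_nonneg ξ]) (by linarith)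

lemma rpow_le_equiKernel {s σ ϰ ξ : ℝ} (hs : 0 ≤ s) (hϰ : 0 < ϰ) (h : ξ ^ 2 ≤ ϰ ^ 2) :
    5 ^ (-s) * ϰ ^ (-(2 * σ) - 1) ≤ equiKernel s σ ϰ ξ := by
  rw [← mul_sq_rpow_mul_rpow (by norm_num) hϰ]
  unfold equiKernel
  refine mul_le_mul_of_nonneg_left ?_ (by positivity)
  exact Real.rpow_le_rpow_of_nonpos (by positivity) (by linarith) (by linarith)

lemma integral_equiKernel {s σ κ : ℝ} (hσ : 0 < σ) (hs : σ < s) (hκ : 0 < κ) (ξ : ℝ) :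
    IntegrableOn (fun ϰ => equiKernel s σ ϰ ξ) (Ioi κ) ∧
    5 ^ (-s) / (2 * σ) * (4 * κ ^ 2 + ξ ^ 2) ^ (-σ) ≤ ∫ ϰ in Ioi κ, equiKernel s σ ϰ ξ ∧
    ∫ ϰ in Ioi κ, equiKernel s σ ϰ ξ ≤
      (1 / (2 * (s - σ)) + 4 ^ (-s) / (2 * σ)) * (4 * κ ^ 2 + ξ ^ 2) ^ (-σ) := by
  have hs0 : 0 ≤ s := by linarith
  have hsσ : 0 < s - σ := by linarith
  set B := 4 * κ ^ 2 + ξ ^ 2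
  have hB0 : 0 < B := by positivity
  set A := Real.sqrt B
  have hA0 : 0 < A := Real.sqrt_pos.2 hB0
  have hAsq : A ^ 2 = B := Real.sq_sqrt hB0.le
  have hApow (t : ℝ) : A ^ (2 * t) = B ^ t := by
    rw [Real.rpow_mul hA0.le, ← hAsq, Real.rpow_two]
  have hκA : κ ≤ A := Real.le_sqrt_of_sq_le (by nlinarith [sq_nonneg ξ, sq_nonneg κ])
  have hmeas : Measurable fun ϰ => equiKernel s σ ϰ ξ :=
    (measurable_equiKernel s σ).comp (measurable_id.prodMk measurable_const)
  have hnear : IntegrableOn (fun ϰ : ℝ => B ^ (-s) * ϰ ^ (2 * (s - σ) - 1)) (Ioc 0 A) :=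
    ((intervalIntegrable_iff_integrableOn_Ioc_of_le hA0.le).1
      (intervalIntegral.intervalIntegrable_rpow' (by linarith))).const_mul _
  have hfar (a : ℝ) : IntegrableOn (fun ϰ : ℝ => a * ϰ ^ (-(2 * σ) - 1)) (Ioi A) :=
    (integrableOn_Ioi_rpow_of_lt (by linarith) hA0).const_mul _
  have hfar_eq (a : ℝ) : ∫ ϰ in Ioi A, a * ϰ ^ (-(2 * σ) - 1) = a / (2 * σ) * B ^ (-σ) := by
    rw [integral_const_mul, integral_Ioi_rpow_of_lt (by linarith) hA0, sub_add_cancel,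
      ← mul_neg, hApow]
    field_simp
  have hsub : Ioc κ A ⊆ Ioc 0 A := Ioc_subset_Ioc_left hκ.le
  have hint_near : IntegrableOn (fun ϰ => equiKernel s σ ϰ ξ) (Ioc κ A) := by
    refine (hnear.mono_set hsub).mono' hmeas.aestronglyMeasurable ?_
    filter_upwards [ae_restrict_mem measurableSet_Ioc] with ϰ hϰ
    rw [Real.norm_of_nonneg (equiKernel_nonneg (hκ.le.trans hϰ.1.le))]
    exact equiKernel_le_of_le hs0 hκ hϰ.1.le
  have hint_far : IntegrableOn (fun ϰ => equiKernel s σ ϰ ξ) (Ioi A) := by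
    refine (hfar (4 ^ (-s))).mono' hmeas.aestronglyMeasurable ?_
    filter_upwards [ae_restrict_mem measurableSet_Ioi] with ϰ hϰ
    have hϰ0 : 0 < ϰ := hA0.trans hϰ
    rw [Real.norm_of_nonneg (equiKernel_nonneg hϰ0.le)]
    exact equiKernel_le_rpow hs0 hϰ0
  have hsplit : ∫ ϰ in Ioi κ, equiKernel s σ ϰ ξ =
      (∫ ϰ in Ioc κ A, equiKernel s σ ϰ ξ) + ∫ ϰ in Ioi A, equiKernel s σ ϰ ξ := by
    rw [← setIntegral_union Ioc_disjoint_Ioi_same measurableSet_Ioi hint_near hint_far,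
      Ioc_union_Ioi_eq_Ioi hκA]
  refine ⟨?_, ?_, ?_⟩
  · rw [← Ioc_union_Ioi_eq_Ioi hκA]
    exact hint_near.union hint_far
  · have h₁ : 0 ≤ ∫ ϰ in Ioc κ A, equiKernel s σ ϰ ξ :=
      setIntegral_nonneg measurableSet_Ioc fun ϰ hϰ =>
        equiKernel_nonneg (hκ.le.trans hϰ.1.le)
    have h₂ := setIntegral_mono_on (hfar (5 ^ (-s))) hint_far measurableSet_Ioi fun ϰ hϰ =>
      rpow_le_equiKernel (ξ := ξ) (σ := σ) hs0 (hA0.trans hϰ) (by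
        have : A < ϰ := hϰ
        nlinarith [sq_nonneg κ])
    rw [hfar_eq] at h₂
    linarith
  · have h₁ : ∫ ϰ in Ioc κ A, equiKernel s σ ϰ ξ ≤ 1 / (2 * (s - σ)) * B ^ (-σ) := by
      calc ∫ ϰ in Ioc κ A, equiKernel s σ ϰ ξ
          ≤ ∫ ϰ in Ioc κ A, B ^ (-s) * ϰ ^ (2 * (s - σ) - 1) :=
            setIntegral_mono_on hint_near (hnear.mono_set hsub) measurableSet_Ioc
              fun ϰ hϰ => equiKernel_le_of_le hs0 hκ hϰ.1.le
        _ ≤ ∫ ϰ in Ioc 0 A, B ^ (-s) * ϰ ^ (2 * (s - σ) - 1) := by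
            refine setIntegral_mono_set hnear ?_ hsub.eventuallyLE
            filter_upwards [ae_restrict_mem measurableSet_Ioc] with ϰ hϰ
            have := hϰ.1
            simp only [Pi.zero_apply]
            positivity
        _ = 1 / (2 * (s - σ)) * B ^ (-σ) := by
            rw [integral_const_mul, ← intervalIntegral.integral_of_le hA0.le,
              integral_rpow (Or.inl (by linarith)), sub_add_cancel, hApow,
              Real.zero_rpow (by positivity), sub_zero, ← mul_div_assoc,
              ← Real.rpow_add hB0]
            ring_nf
    have h₂ := setIntegral_mono_on hint_far (hfar (4 ^ (-s))) measurableSet_Ioi fun ϰ hϰ =>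
      equiKernel_le_rpow (ξ := ξ) (σ := σ) hs0 (hA0.trans hϰ)
    rw [hfar_eq] at h₂
    rw [hsplit, add_mul]
    exact add_le_add h₁ h₂

lemma integrable_equiKernel_mul_of_integrable {s σ ϰ₀ ϰ : ℝ} (hs : 0 ≤ s) (h₀ : 0 < ϰ₀)
    (hϰ : 0 < ϰ) {h : ℝ → ℝ} (hm : Measurable h)
    (hi : Integrable fun ξ => equiKernel s σ ϰ₀ ξ * h ξ) :
    Integrable fun ξ => equiKernel s σ ϰ ξ * h ξ := by
  set M := 1 + ϰ₀ ^ 2 / ϰ ^ 2 with hM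
  have hM0 : 0 < M := by positivity
  set D := ϰ ^ (2 * (s - σ) - 1) * M ^ s * (ϰ₀ ^ (2 * (s - σ) - 1))⁻¹ with hD
  have hD0 : 0 ≤ D := by positivity
  have hmeas : Measurable fun ξ => equiKernel s σ ϰ ξ :=
    (measurable_equiKernel s σ).comp (measurable_const.prodMk measurable_id)
  refine (hi.norm.const_mul D).mono' (hmeas.mul hm).aestronglyMeasurable
    (Filter.Eventually.of_forall fun ξ => ?_)
  rw [norm_mul, norm_mul, ← mul_assoc, Real.norm_of_nonneg (equiKernel_nonneg hϰ.le),
    Real.norm_of_nonneg (equiKernel_nonneg h₀.le)]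
  refine mul_le_mul_of_nonneg_right ?_ (norm_nonneg _)
  have hle : M⁻¹ * (4 * ϰ₀ ^ 2 + ξ ^ 2) ≤ 4 * ϰ ^ 2 + ξ ^ 2 := by
    rw [inv_mul_le_iff₀ hM0]
    have e : ϰ₀ ^ 2 / ϰ ^ 2 * (4 * ϰ ^ 2) = 4 * ϰ₀ ^ 2 := by field_simp
    have : 0 ≤ ϰ₀ ^ 2 / ϰ ^ 2 * ξ ^ 2 := by positivity
    rw [hM]
    nlinarith [sq_nonneg ϰ]
  have hpow : (4 * ϰ ^ 2 + ξ ^ 2) ^ (-s) ≤ M ^ s * (4 * ϰ₀ ^ 2 + ξ ^ 2) ^ (-s) := by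
    refine (Real.rpow_le_rpow_of_nonpos (by positivity) hle (by linarith)).trans_eq ?_
    rw [Real.mul_rpow (by positivity) (by positivity), Real.inv_rpow hM0.le,
      Real.rpow_neg hM0.le, inv_inv]
  have h₁ : 0 < ϰ₀ ^ (2 * (s - σ) - 1) := by positivity
  unfold equiKernel
  calc ϰ ^ (2 * (s - σ) - 1) * (4 * ϰ ^ 2 + ξ ^ 2) ^ (-s)
      ≤ ϰ ^ (2 * (s - σ) - 1) * (M ^ s * (4 * ϰ₀ ^ 2 + ξ ^ 2) ^ (-s)) := by gcongr
    _ = D * (ϰ₀ ^ (2 * (s - σ) - 1) * (4 * ϰ₀ ^ 2 + ξ ^ 2) ^ (-s)) := by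
      rw [hD]
      field_simp

/-- The two-sided bound for a nonnegative measurable density `h`. Neither side needs to be finite:
both integrals take the value zero when the right-hand density is not integrable. -/
lemma integral_integral_equiKernel_mul {s σ κ : ℝ} (hσ : 0 < σ) (hs : σ < s) (hκ : 0 < κ)
    {h : ℝ → ℝ} (hm : Measurable h) (h0 : ∀ ξ, 0 ≤ h ξ) :
    5 ^ (-s) / (2 * σ) * (∫ ξ, (4 * κ ^ 2 + ξ ^ 2) ^ (-σ) * h ξ) ≤
      ∫ ϰ in Ioi κ, ∫ ξ, equiKernel s σ ϰ ξ * h ξ ∧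
    ∫ ϰ in Ioi κ, ∫ ξ, equiKernel s σ ϰ ξ * h ξ ≤
      (1 / (2 * (s - σ)) + 4 ^ (-s) / (2 * σ)) *
        ∫ ξ, (4 * κ ^ 2 + ξ ^ 2) ^ (-σ) * h ξ := by
  have hker := integral_equiKernel hσ hs hκ
  have hFm : Measurable (Function.uncurry fun ϰ ξ : ℝ => equiKernel s σ ϰ ξ * h ξ) :=
    (measurable_equiKernel s σ).mul (hm.comp measurable_snd)
  have hgm : Measurable fun ξ : ℝ => (4 * κ ^ 2 + ξ ^ 2) ^ (-σ) * h ξ := by fun_prop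
  have hKm : AEStronglyMeasurable (fun ξ => ∫ ϰ in Ioi κ, equiKernel s σ ϰ ξ * h ξ) volume :=
    hFm.stronglyMeasurable.integral_prod_left.aestronglyMeasurable
  have hK (ξ : ℝ) : ∫ ϰ in Ioi κ, equiKernel s σ ϰ ξ * h ξ =
      (∫ ϰ in Ioi κ, equiKernel s σ ϰ ξ) * h ξ := integral_mul_const _ _
  have hnorm (ξ : ℝ) : ∫ ϰ in Ioi κ, ‖equiKernel s σ ϰ ξ * h ξ‖ =
      ∫ ϰ in Ioi κ, equiKernel s σ ϰ ξ * h ξ :=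
    setIntegral_congr_fun measurableSet_Ioi fun ϰ hϰ =>
      Real.norm_of_nonneg (mul_nonneg (equiKernel_nonneg (hκ.trans hϰ).le) (h0 ξ))
  have hlow (ξ : ℝ) : 5 ^ (-s) / (2 * σ) * ((4 * κ ^ 2 + ξ ^ 2) ^ (-σ) * h ξ) ≤
      ∫ ϰ in Ioi κ, equiKernel s σ ϰ ξ * h ξ := by
    rw [hK, ← mul_assoc]
    exact mul_le_mul_of_nonneg_right (hker ξ).2.1 (h0 ξ)
  have hupp (ξ : ℝ) : ∫ ϰ in Ioi κ, equiKernel s σ ϰ ξ * h ξ ≤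
      (1 / (2 * (s - σ)) + 4 ^ (-s) / (2 * σ)) * ((4 * κ ^ 2 + ξ ^ 2) ^ (-σ) * h ξ) := by
    rw [hK, ← mul_assoc]
    exact mul_le_mul_of_nonneg_right (hker ξ).2.2 (h0 ξ)
  have hc : 0 < (5 : ℝ) ^ (-s) / (2 * σ) := by positivity
  by_cases hg : Integrable fun ξ : ℝ => (4 * κ ^ 2 + ξ ^ 2) ^ (-σ) * h ξ
  · have hKi : Integrable fun ξ => ∫ ϰ in Ioi κ, equiKernel s σ ϰ ξ * h ξ := by
      refine (hg.const_mul (1 / (2 * (s - σ)) + 4 ^ (-s) / (2 * σ))).mono' hKm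
        (Filter.Eventually.of_forall fun ξ => ?_)
      rw [Real.norm_of_nonneg]
      · exact hupp ξ
      · exact le_trans (by have := h0 ξ; positivity) (hlow ξ)
    have hF : Integrable (Function.uncurry fun ϰ ξ : ℝ => equiKernel s σ ϰ ξ * h ξ)
        ((volume.restrict (Ioi κ)).prod volume) := by
      refine (integrable_prod_iff' hFm.aestronglyMeasurable).2
        ⟨Filter.Eventually.of_forall fun ξ => (hker ξ).1.mul_const (h ξ), ?_⟩
      simpa only [Function.uncurry, hnorm] using hKi
    rw [integral_integral_swap hF, ← integral_const_mul, ← integral_const_mul]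
    exact ⟨integral_mono (hg.const_mul _) hKi hlow, integral_mono hKi (hg.const_mul _) hupp⟩
  · suffices hz : ∫ ϰ in Ioi κ, ∫ ξ, equiKernel s σ ϰ ξ * h ξ = 0 by
      rw [hz, integral_undef hg]
      simp
    by_cases hex : ∃ ϰ₀ > 0, Integrable fun ξ => equiKernel s σ ϰ₀ ξ * h ξ
    · obtain ⟨ϰ₀, hpos, hi⟩ := hex
      refine integral_undef fun hout => hg ?_
      have hF : Integrable (Function.uncurry fun ϰ ξ : ℝ => equiKernel s σ ϰ ξ * h ξ)
          ((volume.restrict (Ioi κ)).prod volume) := by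
        refine (integrable_prod_iff hFm.aestronglyMeasurable).2 ⟨?_, ?_⟩
        · filter_upwards [ae_restrict_mem measurableSet_Ioi] with ϰ hϰ
          exact integrable_equiKernel_mul_of_integrable (hσ.trans hs).le hpos (hκ.trans hϰ) hm hi
        · refine hout.congr ?_
          filter_upwards [ae_restrict_mem measurableSet_Ioi] with ϰ hϰ
          refine integral_congr_ae (Filter.Eventually.of_forall fun ξ => ?_)
          exact (Real.norm_of_nonneg
            (mul_nonneg (equiKernel_nonneg (hκ.trans hϰ).le) (h0 ξ))).symm
      have hKi : Integrable fun ξ => ∫ ϰ in Ioi κ, equiKernel s σ ϰ ξ * h ξ :=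
        hF.integral_prod_right
      refine (hKi.const_mul (5 ^ (-s) / (2 * σ))⁻¹).mono' hgm.aestronglyMeasurable
        (Filter.Eventually.of_forall fun ξ => ?_)
      rw [Real.norm_of_nonneg (by have := h0 ξ; positivity), le_inv_mul_iff₀ hc]
      exact hlow ξ
    · push Not at hex
      exact setIntegral_eq_zero_of_forall_eq_zero fun ϰ hϰ =>
        integral_undef (hex ϰ (hκ.trans hϰ))

lemma Esq_mul_rpow_div (s σ β : ℝ) {ϰ : ℝ} (hϰ : 0 < ϰ) (q : ℝ → ℂ) :
    Esq s (σ + β) ϰ q * ϰ ^ (2 * β) / ϰ =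
      ∫ ξ, equiKernel s σ ϰ ξ * (|ξ| ^ (2 * (σ + β)) * ‖fhat q ξ‖ ^ 2) := by
  unfold Esq equiKernel
  rw [mul_div_assoc, ← integral_mul_const]
  congr 1 with ξ
  have e : ϰ ^ (2 * (s - σ) - 1) = ϰ ^ (2 * (s - (σ + β))) * (ϰ ^ (2 * β) / ϰ) := by
    rw [← mul_div_assoc, ← Real.rpow_add hϰ, Real.rpow_sub_one hϰ.ne']
    ring_nf
  rw [e]
  ring

lemma rpow_mul_Esq_self (σ β : ℝ) {κ : ℝ} (hκ : 0 < κ) (q : ℝ → ℂ) :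
    κ ^ (2 * β) * Esq σ (σ + β) κ q =
      ∫ ξ, (4 * κ ^ 2 + ξ ^ 2) ^ (-σ) * (|ξ| ^ (2 * (σ + β)) * ‖fhat q ξ‖ ^ 2) := by
  unfold Esq
  rw [← integral_const_mul]
  congr 1 with ξ
  have e : κ ^ (2 * β) * κ ^ (2 * (σ - (σ + β))) = 1 := by
    rw [← Real.rpow_add hκ]
    ring_nf
    exact Real.rpow_zero κ
  linear_combination
    (|ξ| ^ (2 * (σ + β)) * (4 * κ ^ 2 + ξ ^ 2) ^ (-σ) * ‖fhat q ξ‖ ^ 2) * e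

/-- **Integrated equicontinuity norms (half-line version).** For `s > σ > 0` and
`β ∈ ℝ` there are `0 < c ≤ C` with
`c κ^{2β} ‖q‖²_{E^{σ+β}_{σ,κ}} ≤ ∫_κ^∞ ‖q‖²_{E^{σ+β}_{s,ϰ}} ϰ^{2β} dϰ/ϰ
  ≤ C κ^{2β} ‖q‖²_{E^{σ+β}_{σ,κ}}` for all `κ ≥ 1` and Schwartz `q`. -/
theorem stmt_11 (s σ β : ℝ) (hσ : 0 < σ) (hs : σ < s) :
    ∃ c C : ℝ, 0 < c ∧ c ≤ C ∧
      ∀ κ : ℝ, 1 ≤ κ → ∀ q : SchwartzMap ℝ ℂ,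
        (c * (κ ^ (2 * β) * Esq σ (σ + β) κ ⇑q)
            ≤ ∫ ϰ in Set.Ioi κ, Esq s (σ + β) ϰ ⇑q * ϰ ^ (2 * β) / ϰ) ∧
        ((∫ ϰ in Set.Ioi κ, Esq s (σ + β) ϰ ⇑q * ϰ ^ (2 * β) / ϰ)
            ≤ C * (κ ^ (2 * β) * Esq σ (σ + β) κ ⇑q)) := by
  have hsσ : 0 < s - σ := by linarith
  refine ⟨5 ^ (-s) / (2 * σ), 1 / (2 * (s - σ)) + 4 ^ (-s) / (2 * σ), by positivity, ?_, ?_⟩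
  · have h₁ : (5 : ℝ) ^ (-s) / (2 * σ) ≤ 4 ^ (-s) / (2 * σ) := by
      gcongr ?_ / _
      exact Real.rpow_le_rpow_of_nonpos (by norm_num) (by norm_num) (by linarith)
    have h₂ : 0 ≤ 1 / (2 * (s - σ)) := by positivity
    linarith
  · intro κ hκ q
    have hκ0 : 0 < κ := by linarith
    rw [rpow_mul_Esq_self σ β hκ0, setIntegral_congr_fun measurableSet_Ioi fun ϰ hϰ =>
      Esq_mul_rpow_div s σ β (hκ0.trans hϰ) q]
    have hq := measurable_fhat q.continuous.measurable
    exact integral_integral_equiKernel_mul hσ hs hκ0 (by fun_prop) fun ξ => by positivity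
end

section
/- Fix σ ∈ (0, 1/2). For κ ≥ 1 and q a Schwartz function, define the operator Λ(κ; q) acting on Schwartz functions u by Λ(κ;q) u := M₋( q · M₊ u ), where M₊ and M₋ are the Fourier multiplier operators with symbols ξ ↦ (κ + iξ)^{−1/2} and ξ ↦ (κ − iξ)^{−1/2} respectively (principal branch square roots, well defined since Re(κ ± iξ) = κ > 0). Then there is a constant C, depending only on σ, such that for every κ ≥ 1, every Schwartz q, and every Schwartz u: √κ · ‖Λ(κ; q) u‖_{L²(ℝ)} ≤ C · ( ∫_ℝ |ξ|^{2σ} (4κ² + ξ²)^{−σ} |q̂(ξ)|² dξ )^{1/2} · ‖u‖_{L²(ℝ)}. In particular, if Q is an L²-bounded and L²-equicontinuous set of Schwartz functions, then √κ times the L²-operator norm of Λ(κ; q) tends to 0 as κ → ∞, uniformly for q ∈ Q. -/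
open MeasureTheory

/-- The inverse Fourier transform, `(2π)^{-1/2} ∫ e^{iξx} g(ξ) dξ`. -/
noncomputable def finv (g : ℝ → ℂ) (x : ℝ) : ℂ :=
  ((Real.sqrt (2 * Real.pi) : ℂ))⁻¹
    * ∫ ξ : ℝ, Complex.exp (Complex.I * (ξ : ℂ) * (x : ℂ)) * g ξ

/-- The Fourier multiplier with symbol `(κ + iξ)^{-1/2}` (principal branch). -/
noncomputable def Mplus (κ : ℝ) (u : ℝ → ℂ) : ℝ → ℂ :=
  finv fun ξ => ((κ : ℂ) + Complex.I * (ξ : ℂ)) ^ (-(1 / 2 : ℂ)) * fhat u ξ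

/-- The Fourier multiplier with symbol `(κ - iξ)^{-1/2}` (principal branch). -/
noncomputable def Mminus (κ : ℝ) (u : ℝ → ℂ) : ℝ → ℂ :=
  finv fun ξ => ((κ : ℂ) - Complex.I * (ξ : ℂ)) ^ (-(1 / 2 : ℂ)) * fhat u ξ

/-- The operator `Λ(κ;q) u = (κ - ∂)^{-1/2} ( q · (κ + ∂)^{-1/2} u )`. -/
noncomputable def Lam (κ : ℝ) (q u : ℝ → ℂ) : ℝ → ℂ :=
  Mminus κ fun x => q x * Mplus κ u x

section

open Complex FourierTransform SchwartzMap
open scoped ENNReal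

theorem hasDerivAt_affine_cpow {κ : ℝ} (hκ : 0 < κ) {b : ℂ} (hb : b.re = 0) (r : ℂ) (ξ : ℝ) :
    HasDerivAt (fun ξ : ℝ => ((κ : ℂ) + b * ξ) ^ r) (r * b * ((κ : ℂ) + b * ξ) ^ (r - 1)) ξ := by
  have h : HasDerivAt (fun z : ℂ => (κ : ℂ) + b * z) b (ξ : ℂ) := by
    simpa using ((hasDerivAt_id (ξ : ℂ)).const_mul b).const_add (κ : ℂ)
  have := (h.cpow_const (c := r) (Complex.mem_slitPlane_iff.2 (Or.inl (by simp [hb, hκ])))).comp_ofReal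
  convert! this using 1
  ring

theorem iteratedDeriv_affine_cpow {κ : ℝ} (hκ : 0 < κ) {b : ℂ} (hb : b.re = 0) (r : ℝ) (n : ℕ) :
    ∃ c : ℂ, iteratedDeriv n (fun ξ : ℝ => ((κ : ℂ) + b * ξ) ^ (r : ℂ)) =
      fun ξ : ℝ => c * ((κ : ℂ) + b * ξ) ^ ((r - n : ℝ) : ℂ) := by
  induction n with
  | zero => exact ⟨1, by simp⟩
  | succ n ih =>
    obtain ⟨c, hc⟩ := ih
    refine ⟨c * ((r - n : ℝ) * b), ?_⟩
    rw [iteratedDeriv_succ, hc]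
    ext ξ
    rw [((hasDerivAt_affine_cpow hκ hb _ ξ).const_mul c).deriv]
    push_cast
    ring_nf

theorem norm_affine_cpow_le {κ : ℝ} (hκ : 0 < κ) {b : ℂ} (hb : b.re = 0) {r : ℝ} (hr : r ≤ 0)
    (ξ : ℝ) : ‖((κ : ℂ) + b * ξ) ^ (r : ℂ)‖ ≤ κ ^ r := by
  rw [Complex.norm_cpow_real]
  refine Real.rpow_le_rpow_of_nonpos hκ ?_ hr
  calc κ = ((κ : ℂ) + b * ξ).re := by simp [hb]
    _ ≤ _ := Complex.re_le_norm _

theorem hasTemperateGrowth_affine_cpow {κ : ℝ} (hκ : 0 < κ) {b : ℂ} (hb : b.re = 0) {r : ℝ}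
    (hr : r ≤ 0) : Function.HasTemperateGrowth fun ξ : ℝ => ((κ : ℂ) + b * ξ) ^ (r : ℂ) := by
  refine ⟨contDiff_of_differentiable_iteratedDeriv fun n _ => ?_, fun n => ?_⟩
  · obtain ⟨c, hc⟩ := iteratedDeriv_affine_cpow hκ hb r n
    rw [hc]
    exact fun ξ => ((hasDerivAt_affine_cpow hκ hb _ ξ).const_mul c).differentiableAt
  · obtain ⟨c, hc⟩ := iteratedDeriv_affine_cpow hκ hb r n
    refine ⟨0, ‖c‖ * κ ^ (r - n), fun ξ => ?_⟩
    rw [norm_iteratedFDeriv_eq_norm_iteratedDeriv, hc, norm_mul, pow_zero, mul_one]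
    gcongr
    have : (0 : ℝ) ≤ n := n.cast_nonneg
    exact norm_affine_cpow_le hκ hb (by linarith) ξ

theorem fhat_eq_fourier (f : ℝ → ℂ) (ξ : ℝ) :
    fhat f ξ = ((Real.sqrt (2 * Real.pi) : ℂ))⁻¹ * 𝓕 f ((2 * Real.pi)⁻¹ * ξ) := by
  rw [fhat, Real.fourier_eq']
  congr 2
  ext x
  rw [smul_eq_mul]
  congr 2
  have : (Real.pi : ℂ) ≠ 0 := by exact_mod_cast Real.pi_ne_zero
  simp
  field_simp

theorem finv_eq_fhat_neg (f : ℝ → ℂ) (x : ℝ) : finv f x = fhat f (-x) := by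
  rw [finv, fhat]
  congr 2
  ext y
  congr 2
  push_cast
  ring

/-- **Plancherel** for `fhat` on Schwartz functions. -/
theorem exists_schwartzMap_fhat (f : 𝓢(ℝ, ℂ)) :
    ∃ g : 𝓢(ℝ, ℂ), ⇑g = fhat f ∧ ∫ ξ, ‖g ξ‖ ^ 2 = ∫ x, ‖f x‖ ^ 2 := by
  have hpi : (2 * Real.pi)⁻¹ ≠ 0 := by positivity
  let e : ℝ ≃L[ℝ] ℝ := ContinuousLinearEquiv.unitsEquivAut ℝ (Units.mk0 _ hpi)
  let g : 𝓢(ℝ, ℂ) := ((Real.sqrt (2 * Real.pi) : ℂ))⁻¹ •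
    SchwartzMap.compCLMOfContinuousLinearEquiv ℂ e (𝓕 f)
  have hg : ⇑g = fhat f := by
    ext ξ
    rw [fhat_eq_fourier, ← SchwartzMap.fourier_coe]
    simp [g, e, mul_comm]
  refine ⟨g, hg, ?_⟩
  rw [← SchwartzMap.integral_norm_sq_fourier f, hg]
  have : ∀ ξ, ‖fhat f ξ‖ ^ 2 =
      (2 * Real.pi)⁻¹ * (fun η => ‖(𝓕 f) η‖ ^ 2) ((2 * Real.pi)⁻¹ * ξ) := by
    intro ξ
    rw [fhat_eq_fourier, ← SchwartzMap.fourier_coe, norm_mul, mul_pow]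
    simp only [norm_inv, Complex.norm_real, Real.norm_eq_abs, inv_pow, sq_abs]
    rw [Real.sq_sqrt (by positivity)]
  simp_rw [this]
  rw [integral_const_mul, Measure.integral_comp_mul_left fun η => ‖(𝓕 f : 𝓢(ℝ, ℂ)) η‖ ^ 2]
  rw [abs_of_pos (by positivity), inv_inv, smul_eq_mul, ← mul_assoc, inv_mul_cancel₀, one_mul]
  positivity

theorem exists_schwartzMap_finv (f : 𝓢(ℝ, ℂ)) :
    ∃ g : 𝓢(ℝ, ℂ), ⇑g = finv f ∧ ∫ ξ, ‖g ξ‖ ^ 2 = ∫ x, ‖f x‖ ^ 2 := by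
  obtain ⟨g, hg, hn⟩ := exists_schwartzMap_fhat f
  refine ⟨SchwartzMap.compCLMOfContinuousLinearEquiv ℂ (ContinuousLinearEquiv.neg ℝ) g, ?_, ?_⟩
  · ext x
    simp [finv_eq_fhat_neg, ← hg]
  · rw [← hn, ← integral_neg_eq_self]
    simp

theorem SchwartzMap.lintegral_enorm_sq (f : 𝓢(ℝ, ℂ)) :
    ∫⁻ x, ‖f x‖ₑ ^ 2 = ENNReal.ofReal (∫ x, ‖f x‖ ^ 2) := by
  rw [ofReal_integral_eq_lintegral_ofReal]
  · simp_rw [ENNReal.ofReal_pow (norm_nonneg _), ofReal_norm]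
  · exact (memLp_two_iff_integrable_sq_norm f.continuous.aestronglyMeasurable).1 (f.memLp 2)
  · exact Filter.Eventually.of_forall fun x => by positivity

theorem fhat_mul_finv {q h : ℝ → ℂ} (hq : Integrable q) (hh : Integrable h) (ξ : ℝ) :
    fhat (fun x => q x * finv h x) ξ =
      ((Real.sqrt (2 * Real.pi) : ℂ))⁻¹ * ∫ η, h η * fhat q (ξ - η) := by
  simp only [fhat, finv]
  congr 1
  have h1 : Integrable (fun p : ℝ × ℝ => ((Real.sqrt (2 * Real.pi) : ℂ))⁻¹ *
      (exp (-(I * (ξ - p.2) * p.1)) * (q p.1 * h p.2))) (volume.prod volume) := by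
    refine Integrable.const_mul ?_ _
    refine (hq.mul_prod hh).bdd_mul (c := 1) (by fun_prop) (Filter.Eventually.of_forall fun p => ?_)
    rw [Complex.norm_exp]
    simp
  calc _ = ∫ x : ℝ, ∫ η : ℝ, ((Real.sqrt (2 * Real.pi) : ℂ))⁻¹ *
      (exp (-(I * (ξ - η) * x)) * (q x * h η)) := by
        congr 1; ext x
        rw [← integral_const_mul, ← integral_const_mul, ← integral_const_mul]
        congr 1; ext η
        rw [show -(I * ((ξ : ℂ) - η) * x) = -(I * ξ * x) + I * η * x by ring, Complex.exp_add]
        ring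
    _ = ∫ η : ℝ, ∫ x : ℝ, ((Real.sqrt (2 * Real.pi) : ℂ))⁻¹ *
      (exp (-(I * (ξ - η) * x)) * (q x * h η)) := integral_integral_swap h1
    _ = _ := by
        congr 1; ext η
        rw [← integral_const_mul, ← integral_const_mul]
        congr 1; ext x
        push_cast
        ring

/-! ### Kernel estimates -/

/-- Cauchy–Schwarz for the lower Lebesgue integral. -/
theorem lintegral_mul_sq_le {α : Type*} [MeasurableSpace α] {μ : Measure α} {f g : α → ℝ≥0∞}
    (hf : AEMeasurable f μ) (hg : AEMeasurable g μ) :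
    (∫⁻ x, f x * g x ∂μ) ^ 2 ≤ (∫⁻ x, f x ^ 2 ∂μ) * ∫⁻ x, g x ^ 2 ∂μ := by
  have h := ENNReal.lintegral_mul_le_Lp_mul_Lq μ Real.HolderConjugate.two_two hf hg
  simp only [Pi.mul_apply, ENNReal.rpow_two] at h
  calc _ ≤ ((∫⁻ x, f x ^ 2 ∂μ) ^ (1 / 2 : ℝ) * (∫⁻ x, g x ^ 2 ∂μ) ^ (1 / 2 : ℝ)) ^ 2 := by gcongr
    _ = _ := by
      rw [mul_pow, ← ENNReal.rpow_mul_natCast, ← ENNReal.rpow_mul_natCast]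
      norm_num

theorem lintegral_eq_mul_lintegral_comp_mul {κ : ℝ} (hκ : 0 < κ) {f : ℝ → ℝ≥0∞}
    (hf : Measurable f) : ∫⁻ x, f x = ENNReal.ofReal κ * ∫⁻ t, f (κ * t) := by
  conv_lhs => rw [← Real.smul_map_volume_mul_left hκ.ne']
  rw [lintegral_smul_measure, lintegral_map hf (by fun_prop), abs_of_pos hκ, smul_eq_mul]

/-- The absolute value `(κ² + ξ²)^{-1/4}` of the symbols `(κ ± iξ)^{-1/2}`. -/
noncomputable def symbolNorm (κ ξ : ℝ) : ℝ≥0∞ :=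
  ENNReal.ofReal ((κ ^ 2 + ξ ^ 2) ^ (-(1 / 4) : ℝ))

@[fun_prop]
theorem measurable_symbolNorm (κ : ℝ) : Measurable (symbolNorm κ) := by
  unfold symbolNorm
  fun_prop

theorem symbolNorm_sq (κ ξ : ℝ) :
    symbolNorm κ ξ ^ 2 = ENNReal.ofReal ((κ ^ 2 + ξ ^ 2) ^ (-(1 / 2) : ℝ)) := by
  rw [symbolNorm, ← ENNReal.ofReal_pow (by positivity), ← Real.rpow_mul_natCast (by positivity)]
  norm_num

theorem symbolNorm_sq_le {κ : ℝ} (hκ : 0 < κ) (ξ : ℝ) :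
    symbolNorm κ ξ ^ 2 ≤ ENNReal.ofReal κ⁻¹ := by
  rw [symbolNorm_sq]
  refine ENNReal.ofReal_le_ofReal ?_
  calc (κ ^ 2 + ξ ^ 2) ^ (-(1 / 2) : ℝ) ≤ (κ ^ 2) ^ (-(1 / 2) : ℝ) :=
        Real.rpow_le_rpow_of_nonpos (by positivity) (by nlinarith [sq_nonneg ξ]) (by norm_num)
    _ = κ⁻¹ := by
        rw [← Real.rpow_natCast, ← Real.rpow_mul hκ.le]
        norm_num [Real.rpow_neg_one]

theorem symbolNorm_sq_mul {κ : ℝ} (hκ : 0 < κ) (t : ℝ) :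
    symbolNorm κ (κ * t) ^ 2 = ENNReal.ofReal κ⁻¹ * symbolNorm 1 t ^ 2 := by
  rw [symbolNorm_sq, symbolNorm_sq, ← ENNReal.ofReal_mul (by positivity)]
  rw [show κ ^ 2 + (κ * t) ^ 2 = κ ^ 2 * (1 ^ 2 + t ^ 2) by ring,
    Real.mul_rpow (by positivity) (by positivity)]
  congr 2
  rw [← Real.rpow_natCast, ← Real.rpow_mul hκ.le]
  norm_num [Real.rpow_neg_one]

theorem lintegral_symbolNorm_pow_four {κ : ℝ} (hκ : 0 < κ) :
    ∫⁻ ξ, (symbolNorm κ ξ ^ 2) ^ 2 = ENNReal.ofReal κ⁻¹ * ENNReal.ofReal Real.pi := by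
  have h1 : ∫⁻ t, (symbolNorm 1 t ^ 2) ^ 2 = ENNReal.ofReal Real.pi := by
    rw [← integral_univ_inv_one_add_sq,
      ofReal_integral_eq_lintegral_ofReal integrable_inv_one_add_sq
        (Filter.Eventually.of_forall fun x => by positivity)]
    refine lintegral_congr fun t => ?_
    rw [symbolNorm_sq, ← ENNReal.ofReal_pow (by positivity),
      ← Real.rpow_mul_natCast (by positivity)]
    norm_num [Real.rpow_neg_one]
  rw [lintegral_eq_mul_lintegral_comp_mul hκ (by fun_prop)]
  simp_rw [symbolNorm_sq_mul hκ, mul_pow]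
  rw [lintegral_const_mul _ (by fun_prop), h1, ← mul_assoc, sq, ← mul_assoc,
    ← ENNReal.ofReal_mul hκ.le, mul_inv_cancel₀ hκ.ne', ENNReal.ofReal_one, one_mul]

/-- An integrable majorant of `|z|^{-2σ}` that has the same singularity at the origin. -/
noncomputable def rieszMajorant (σ z : ℝ) : ℝ :=
  if |z| ≤ 1 then |z| ^ (-(2 * σ)) else |z| ^ (-(2 * σ) - 1)

theorem integrable_rieszMajorant {σ : ℝ} (hσ : 0 < σ) (hσ' : σ < 1 / 2) :
    Integrable (rieszMajorant σ) := by
  have h := (integrable_fun_norm_addHaar (E := ℝ) volume (F := ℝ)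
    (f := fun z => if z ≤ 1 then z ^ (-(2 * σ)) else z ^ (-(2 * σ) - 1))).2
  refine h ?_
  simp only [Module.finrank_self, Nat.sub_self, pow_zero, one_smul]
  rw [← Set.Ioc_union_Ioi_eq_Ioi zero_le_one]
  refine IntegrableOn.union ?_ ?_
  · have : IntegrableOn (fun z : ℝ => z ^ (-(2 * σ))) (Set.Ioc 0 1) :=
      (intervalIntegrable_iff_integrableOn_Ioc_of_le zero_le_one).1
        (intervalIntegral.intervalIntegrable_rpow' (by linarith))
    refine this.congr_fun (fun z hz => ?_) measurableSet_Ioc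
    simp [hz.2]
  · have : IntegrableOn (fun z : ℝ => z ^ (-(2 * σ) - 1)) (Set.Ioi 1) :=
      integrableOn_Ioi_rpow_of_lt (by linarith) one_pos
    refine this.congr_fun (fun z hz => ?_) measurableSet_Ioi
    simp [not_le.2 (Set.mem_Ioi.1 hz)]

theorem rpow_mul_bracket_le {σ : ℝ} (hσ : 0 < σ) (s t : ℝ) :
    |t - s| ^ (-(2 * σ)) * (1 ^ 2 + t ^ 2) ^ (-(1 / 2) : ℝ) ≤
      rieszMajorant σ (t - s) + (1 + ‖t‖ ^ 2) ^ (-(2 * σ + 1) / 2) := by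
  set a := |t - s| with ha
  set b := Real.sqrt (1 + t ^ 2) with hb
  have hb1 : 1 ≤ b := Real.one_le_sqrt.2 (by nlinarith [sq_nonneg t])
  have hb0 : 0 < b := by linarith
  have ha0 : 0 ≤ a := abs_nonneg _
  have hb2 : 1 + t ^ 2 = b ^ (2 : ℝ) := by
    rw [Real.rpow_two, Real.sq_sqrt (by positivity)]
  have e1 : ((1 : ℝ) ^ 2 + t ^ 2) ^ (-(1 / 2) : ℝ) = b ^ (-1 : ℝ) := by
    rw [one_pow, hb2, ← Real.rpow_mul hb0.le]; norm_num
  have e2 : (1 + ‖t‖ ^ 2) ^ (-(2 * σ + 1) / 2) = b ^ (-(2 * σ) - 1) := by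
    rw [Real.norm_eq_abs, sq_abs, hb2, ← Real.rpow_mul hb0.le]; congr 1; ring
  rw [e1, e2, rieszMajorant, ← ha]
  split_ifs with h
  · have : b ^ (-1 : ℝ) ≤ 1 := Real.rpow_le_one_of_one_le_of_nonpos hb1 (by norm_num)
    calc _ ≤ a ^ (-(2 * σ)) * 1 := by gcongr
      _ ≤ _ := by rw [mul_one]; exact le_add_of_nonneg_right (by positivity)
  · push Not at h
    have ha1 : 0 < a := by linarith
    rcases le_total a b with hab | hab
    · calc _ ≤ a ^ (-(2 * σ)) * a ^ (-1 : ℝ) := by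
            gcongr 1
            exact Real.rpow_le_rpow_of_nonpos ha1 hab (by norm_num)
        _ = a ^ (-(2 * σ) - 1) := by rw [← Real.rpow_add ha1]; rfl
        _ ≤ _ := le_add_of_nonneg_right (by positivity)
    · calc _ ≤ b ^ (-(2 * σ)) * b ^ (-1 : ℝ) := by
            gcongr 1
            exact Real.rpow_le_rpow_of_nonpos hb0 hab (by linarith)
        _ = b ^ (-(2 * σ) - 1) := by rw [← Real.rpow_add hb0]; rfl
        _ ≤ _ := le_add_of_nonneg_left (by positivity)

theorem exists_lintegral_riesz_mul_symbolNorm_le {σ : ℝ} (hσ : 0 < σ) (hσ' : σ < 1 / 2) :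
    ∃ C : ℝ, 0 ≤ C ∧ ∀ κ : ℝ, 0 < κ → ∀ η : ℝ,
      ∫⁻ ξ, ENNReal.ofReal (|ξ - η| ^ (-(2 * σ))) * symbolNorm κ ξ ^ 2 ≤
        ENNReal.ofReal (C * κ ^ (-(2 * σ))) := by
  have hP := integrable_rieszMajorant hσ hσ'
  have hB : Integrable fun t : ℝ => (1 + ‖t‖ ^ 2) ^ (-(2 * σ + 1) / 2) :=
    integrable_rpow_neg_one_add_norm_sq (by simp [hσ])
  have hP0 : ∀ z, 0 ≤ rieszMajorant σ z := fun z => by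
    unfold rieszMajorant; split_ifs <;> positivity
  refine ⟨(∫ z, rieszMajorant σ z) + ∫ t : ℝ, (1 + ‖t‖ ^ 2) ^ (-(2 * σ + 1) / 2),
    add_nonneg (integral_nonneg hP0) (integral_nonneg fun t => by positivity), ?_⟩
  intro κ hκ η
  have key (s : ℝ) : ∫⁻ t, ENNReal.ofReal (|t - s| ^ (-(2 * σ))) * symbolNorm 1 t ^ 2 ≤
      ENNReal.ofReal ((∫ z, rieszMajorant σ z) + ∫ t : ℝ, (1 + ‖t‖ ^ 2) ^ (-(2 * σ + 1) / 2)) := by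
    have hPs : Integrable fun t => rieszMajorant σ (t - s) := hP.comp_sub_right s
    rw [← integral_sub_right_eq_self (rieszMajorant σ) s, ← integral_add hPs hB,
      ofReal_integral_eq_lintegral_ofReal (hPs.fun_add hB)
        (Filter.Eventually.of_forall fun t => add_nonneg (hP0 _) (by positivity))]
    refine lintegral_mono fun t => ?_
    rw [symbolNorm_sq, ← ENNReal.ofReal_mul (by positivity)]
    exact ENNReal.ofReal_le_ofReal (rpow_mul_bracket_le hσ s t)
  rw [lintegral_eq_mul_lintegral_comp_mul hκ (by fun_prop)]
  have e (t : ℝ) : ENNReal.ofReal (|κ * t - η| ^ (-(2 * σ))) * symbolNorm κ (κ * t) ^ 2 =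
      ENNReal.ofReal (κ ^ (-(2 * σ)) * κ⁻¹) *
        (ENNReal.ofReal (|t - η / κ| ^ (-(2 * σ))) * symbolNorm 1 t ^ 2) := by
    rw [symbolNorm_sq_mul hκ, show κ * t - η = κ * (t - η / κ) by field_simp, abs_mul,
      abs_of_pos hκ, Real.mul_rpow hκ.le (abs_nonneg _), ENNReal.ofReal_mul (by positivity),
      ENNReal.ofReal_mul (by positivity)]
    ring
  simp_rw [e]
  rw [lintegral_const_mul _ (by fun_prop), ← mul_assoc, ← ENNReal.ofReal_mul hκ.le,
    show κ * (κ ^ (-(2 * σ)) * κ⁻¹) = κ ^ (-(2 * σ)) by field_simp,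
    mul_comm _ (κ ^ (-(2 * σ))), ENNReal.ofReal_mul (by positivity)]
  gcongr
  exact key _

theorem lintegral_low_frequency_le {κ : ℝ} {P D B : ℝ → ℝ≥0∞} (hP : Measurable P)
    (hD : Measurable D) (hB : Measurable B) {K : ℝ≥0∞}
    (hK : ∀ η, symbolNorm κ η ^ 2 * ∫⁻ ξ, P (ξ - η) ^ 2 * symbolNorm κ ξ ^ 2 ≤ K) :
    ∫⁻ ξ, (symbolNorm κ ξ * ∫⁻ η, P (ξ - η) * D (ξ - η) * (symbolNorm κ η * B η)) ^ 2 ≤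
      K * (∫⁻ ζ, D ζ ^ 2) * ∫⁻ η, B η ^ 2 := by
  calc _ ≤ ∫⁻ ξ, (∫⁻ ζ, D ζ ^ 2) *
        ∫⁻ η, symbolNorm κ ξ ^ 2 * (P (ξ - η) * (symbolNorm κ η * B η)) ^ 2 := by
        refine lintegral_mono fun ξ => ?_
        rw [mul_pow, lintegral_const_mul _ (by fun_prop), mul_left_comm]
        gcongr
        calc _ = (∫⁻ η, D (ξ - η) * (P (ξ - η) * (symbolNorm κ η * B η))) ^ 2 := by
              congr 2; ext η; ring
          _ ≤ _ := lintegral_mul_sq_le (by fun_prop) (by fun_prop)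
          _ = _ := by rw [lintegral_sub_left_eq_self (fun ζ => D ζ ^ 2) ξ]
    _ = (∫⁻ ζ, D ζ ^ 2) * ∫⁻ η, ∫⁻ ξ,
          symbolNorm κ ξ ^ 2 * (P (ξ - η) * (symbolNorm κ η * B η)) ^ 2 := by
        rw [lintegral_const_mul _ (by fun_prop), lintegral_lintegral_swap (by fun_prop)]
    _ ≤ (∫⁻ ζ, D ζ ^ 2) * ∫⁻ η, K * B η ^ 2 := by
        gcongr with η
        calc _ = ∫⁻ ξ, B η ^ 2 * symbolNorm κ η ^ 2 * (P (ξ - η) ^ 2 * symbolNorm κ ξ ^ 2) := by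
              congr 1; ext ξ; ring
          _ = B η ^ 2 * (symbolNorm κ η ^ 2 * ∫⁻ ξ, P (ξ - η) ^ 2 * symbolNorm κ ξ ^ 2) := by
              rw [lintegral_const_mul _ (by fun_prop), mul_assoc]
          _ ≤ _ := by
              rw [mul_comm]
              gcongr
              exact hK η
    _ = _ := by rw [lintegral_const_mul _ (by fun_prop)]; ring

theorem lintegral_high_frequency_le {κ : ℝ} {D B : ℝ → ℝ≥0∞}
    (hD : Measurable D) (hB : Measurable B) :
    ∫⁻ ξ, (symbolNorm κ ξ * ∫⁻ η, D (ξ - η) * (symbolNorm κ η * B η)) ^ 2 ≤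
      (∫⁻ ξ, (symbolNorm κ ξ ^ 2) ^ 2) * (∫⁻ ζ, D ζ ^ 2) * ∫⁻ η, B η ^ 2 := by
  have hcs (ζ : ℝ) : ∫⁻ ξ, symbolNorm κ ξ ^ 2 * symbolNorm κ (ξ - ζ) ^ 2 ≤
      ∫⁻ ξ, (symbolNorm κ ξ ^ 2) ^ 2 := by
    have h := lintegral_mul_sq_le (μ := volume) (f := fun ξ => symbolNorm κ ξ ^ 2)
      (g := fun ξ => symbolNorm κ (ξ - ζ) ^ 2) (by fun_prop) (by fun_prop)
    rw [lintegral_sub_right_eq_self (fun ξ => (symbolNorm κ ξ ^ 2) ^ 2) ζ, ← sq] at h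
    exact (ENNReal.pow_le_pow_left_iff two_ne_zero).1 h
  calc _ ≤ ∫⁻ ξ, (∫⁻ η, B η ^ 2) *
        ∫⁻ ζ, symbolNorm κ ξ ^ 2 * (D ζ * symbolNorm κ (ξ - ζ)) ^ 2 := by
        refine lintegral_mono fun ξ => ?_
        rw [mul_pow, lintegral_const_mul _ (by fun_prop), mul_left_comm]
        gcongr
        calc _ = (∫⁻ η, B η * (D (ξ - η) * symbolNorm κ η)) ^ 2 := by
              congr 2; ext η; ring
          _ ≤ _ := lintegral_mul_sq_le (by fun_prop) (by fun_prop)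
          _ = _ := by
              rw [← lintegral_sub_left_eq_self (fun ζ => (D ζ * symbolNorm κ (ξ - ζ)) ^ 2) ξ]
              simp
    _ = (∫⁻ η, B η ^ 2) * ∫⁻ ζ, ∫⁻ ξ,
          symbolNorm κ ξ ^ 2 * (D ζ * symbolNorm κ (ξ - ζ)) ^ 2 := by
        rw [lintegral_const_mul _ (by fun_prop), lintegral_lintegral_swap (by fun_prop)]
    _ ≤ (∫⁻ η, B η ^ 2) * ∫⁻ ζ, (∫⁻ ξ, (symbolNorm κ ξ ^ 2) ^ 2) * D ζ ^ 2 := by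
        gcongr with ζ
        calc _ = ∫⁻ ξ, D ζ ^ 2 * (symbolNorm κ ξ ^ 2 * symbolNorm κ (ξ - ζ) ^ 2) := by
              congr 1; ext ξ; ring
          _ ≤ _ := by
              rw [lintegral_const_mul _ (by fun_prop), mul_comm]
              gcongr ?_ * _
              exact hcs ζ
    _ = _ := by rw [lintegral_const_mul _ (by fun_prop)]; ring

theorem ENNReal.add_sq_le_two_mul (a b : ℝ≥0∞) : (a + b) ^ 2 ≤ 2 * (a ^ 2 + b ^ 2) := by
  have h := ENNReal.rpow_add_le_mul_rpow_add_rpow a b one_le_two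
  norm_num at h
  exact h

theorem enorm_symbol (κ ξ : ℝ) {b : ℂ} (hb : b = I ∨ b = -I) :
    ‖((κ : ℂ) + b * ξ) ^ (-(1 / 2 : ℂ))‖ₑ = symbolNorm κ ξ := by
  have h : ‖(κ : ℂ) + b * ξ‖ = (κ ^ 2 + ξ ^ 2) ^ (1 / 2 : ℝ) := by
    rw [Complex.norm_def, Complex.normSq_apply, Real.sqrt_eq_rpow]
    rcases hb with rfl | rfl <;> simp <;> ring_nf
  rw [← ofReal_norm, show (-(1 / 2 : ℂ)) = ((-(1 / 2) : ℝ) : ℂ) by push_cast; rfl,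
    Complex.norm_cpow_real, h, ← Real.rpow_mul (by positivity), symbolNorm]
  norm_num

/-- The density `|ζ|^σ (4κ² + ζ²)^{-σ/2}` of the `E^σ_{σ,κ}` norm. -/
noncomputable def equiWeight (σ κ ζ : ℝ) : ℝ :=
  |ζ| ^ σ * (4 * κ ^ 2 + ζ ^ 2) ^ (-σ / 2)

theorem equiWeight_nonneg (σ κ ζ : ℝ) : 0 ≤ equiWeight σ κ ζ := by
  unfold equiWeight; positivity

@[fun_prop]
theorem measurable_equiWeight (σ κ : ℝ) : Measurable (equiWeight σ κ) := by
  unfold equiWeight; fun_prop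

theorem equiWeight_sq (σ κ ζ : ℝ) :
    equiWeight σ κ ζ ^ 2 = |ζ| ^ (2 * σ) * (4 * κ ^ 2 + ζ ^ 2) ^ (-σ) := by
  rw [equiWeight, mul_pow, ← Real.rpow_mul_natCast (by positivity),
    ← Real.rpow_mul_natCast (by positivity)]
  congr 2 <;> push_cast <;> ring

theorem one_le_mul_equiWeight {σ κ ζ : ℝ} (hσ : 0 < σ) (hσ' : σ < 1 / 2) (hκ : 0 < κ)
    (hζ : ζ ≠ 0) : 1 ≤ (1 + (2 * κ) ^ σ * |ζ| ^ (-σ)) * equiWeight σ κ ζ := by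
  have hz : 0 < |ζ| := abs_pos.2 hζ
  have h : (4 * κ ^ 2 + ζ ^ 2) ^ (σ / 2) ≤ (2 * κ) ^ σ + |ζ| ^ σ := by
    calc (4 * κ ^ 2 + ζ ^ 2) ^ (σ / 2) ≤ (4 * κ ^ 2) ^ (σ / 2) + (ζ ^ 2) ^ (σ / 2) :=
          Real.rpow_add_le_add_rpow (by positivity) (by positivity) (by linarith) (by linarith)
      _ = _ := by
          rw [← sq_abs ζ, show 4 * κ ^ 2 = (2 * κ) ^ 2 by ring, ← Real.rpow_natCast_mul hz.le,
            ← Real.rpow_natCast_mul (by positivity)]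
          congr 2 <;> push_cast <;> ring
  have hp : 0 < (4 * κ ^ 2 + ζ ^ 2) ^ (σ / 2) := by positivity
  rw [equiWeight, neg_div, Real.rpow_neg hz.le, Real.rpow_neg (by positivity), ← mul_assoc,
    ← div_eq_mul_inv, le_div_iff₀ hp, one_mul]
  have : 0 < |ζ| ^ σ := by positivity
  calc _ ≤ _ := h
    _ = _ := by field_simp; ring

/-- The positive-kernel form of the operator bound, with explicit dependence on `κ`. -/
theorem exists_lintegral_kernel_le {σ : ℝ} (hσ : 0 < σ) (hσ' : σ < 1 / 2) :
    ∃ C : ℝ, 0 < C ∧ ∀ κ : ℝ, 0 < κ → ∀ A B : ℝ → ℝ≥0∞, Measurable A → Measurable B →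
      ENNReal.ofReal κ *
          ∫⁻ ξ, (symbolNorm κ ξ * ∫⁻ η, A (ξ - η) * (symbolNorm κ η * B η)) ^ 2 ≤
        ENNReal.ofReal C * (∫⁻ ζ, (ENNReal.ofReal (equiWeight σ κ ζ) * A ζ) ^ 2) *
          ∫⁻ η, B η ^ 2 := by
  obtain ⟨C, hC, hker⟩ := exists_lintegral_riesz_mul_symbolNorm_le hσ hσ'
  refine ⟨2 * (Real.pi + 2 ^ (2 * σ) * C), by positivity, ?_⟩
  intro κ hκ A B hA hB
  set D : ℝ → ℝ≥0∞ := fun ζ => ENNReal.ofReal (equiWeight σ κ ζ) * A ζ with hDdef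
  set P : ℝ → ℝ≥0∞ := fun ζ => ENNReal.ofReal ((2 * κ) ^ σ * |ζ| ^ (-σ)) with hPdef
  have hD : Measurable D := by fun_prop
  have hP : Measurable P := by fun_prop
  have hAD (ζ : ℝ) (hζ : ζ ≠ 0) : A ζ ≤ (1 + P ζ) * D ζ := by
    have h := ENNReal.ofReal_le_ofReal (one_le_mul_equiWeight hσ hσ' hκ hζ)
    rw [ENNReal.ofReal_mul (by positivity), ENNReal.ofReal_add zero_le_one (by positivity),
      ENNReal.ofReal_one] at h
    calc A ζ = 1 * A ζ := (one_mul _).symm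
      _ ≤ _ := by rw [hDdef, ← mul_assoc]; gcongr
  have hlow := lintegral_low_frequency_le (κ := κ) hP hD hB
    (K := ENNReal.ofReal (κ⁻¹ * (2 ^ (2 * σ) * C))) (fun η => by
      have e (ξ : ℝ) : P (ξ - η) ^ 2 * symbolNorm κ ξ ^ 2 = ENNReal.ofReal ((2 * κ) ^ (2 * σ)) *
          (ENNReal.ofReal (|ξ - η| ^ (-(2 * σ))) * symbolNorm κ ξ ^ 2) := by
        rw [hPdef, ← mul_assoc, ← ENNReal.ofReal_mul (by positivity),
          ← ENNReal.ofReal_pow (by positivity), mul_pow, ← Real.rpow_mul_natCast (by positivity),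
          ← Real.rpow_mul_natCast (by positivity)]
        congr 3 <;> congr 1 <;> push_cast <;> ring
      simp_rw [e]
      rw [lintegral_const_mul _ (by fun_prop)]
      calc _ ≤ ENNReal.ofReal κ⁻¹ * (ENNReal.ofReal ((2 * κ) ^ (2 * σ)) *
            ENNReal.ofReal (C * κ ^ (-(2 * σ)))) := by
            gcongr
            · exact symbolNorm_sq_le hκ η
            · exact hker κ hκ η
        _ = _ := by
            rw [← ENNReal.ofReal_mul (by positivity), ← ENNReal.ofReal_mul (by positivity),
              Real.mul_rpow zero_le_two hκ.le, Real.rpow_neg hκ.le]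
            congr 2
            have : 0 < κ ^ (2 * σ) := by positivity
            field_simp)
  have hhigh := lintegral_high_frequency_le (κ := κ) hD hB
  rw [lintegral_symbolNorm_pow_four hκ, ← ENNReal.ofReal_mul (by positivity)] at hhigh
  calc _ ≤ ENNReal.ofReal κ * ∫⁻ ξ,
        2 * ((symbolNorm κ ξ * ∫⁻ η, D (ξ - η) * (symbolNorm κ η * B η)) ^ 2 +
          (symbolNorm κ ξ * ∫⁻ η, P (ξ - η) * D (ξ - η) * (symbolNorm κ η * B η)) ^ 2) := by
        gcongr with ξ
        refine le_trans ?_ (ENNReal.add_sq_le_two_mul _ _)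
        rw [← mul_add, ← lintegral_add_left (by fun_prop)]
        gcongr 2
        refine lintegral_mono_ae ?_
        filter_upwards [Measure.ae_ne volume ξ] with η hη
        rw [← add_mul, ← one_add_mul]
        gcongr
        exact hAD _ (sub_ne_zero.2 hη.symm)
    _ = ENNReal.ofReal κ * (2 *
        ((∫⁻ ξ, (symbolNorm κ ξ * ∫⁻ η, D (ξ - η) * (symbolNorm κ η * B η)) ^ 2) +
        ∫⁻ ξ, (symbolNorm κ ξ * ∫⁻ η, P (ξ - η) * D (ξ - η) * (symbolNorm κ η * B η)) ^ 2)) := by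
        rw [lintegral_const_mul _ (by fun_prop), lintegral_add_left (by fun_prop)]
    _ ≤ ENNReal.ofReal κ * (2 * (
        ENNReal.ofReal (κ⁻¹ * Real.pi) * (∫⁻ ζ, D ζ ^ 2) * (∫⁻ η, B η ^ 2) +
        ENNReal.ofReal (κ⁻¹ * (2 ^ (2 * σ) * C)) * (∫⁻ ζ, D ζ ^ 2) * ∫⁻ η, B η ^ 2)) := by
        gcongr
    _ = ENNReal.ofReal κ * 2 * (ENNReal.ofReal (κ⁻¹ * Real.pi) +
        ENNReal.ofReal (κ⁻¹ * (2 ^ (2 * σ) * C))) * (∫⁻ ζ, D ζ ^ 2) * ∫⁻ η, B η ^ 2 := by ring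
    _ = _ := by
        rw [← ENNReal.ofReal_add (by positivity) (by positivity),
          show (2 : ℝ≥0∞) = ENNReal.ofReal 2 by simp, ← ENNReal.ofReal_mul hκ.le,
          ← ENNReal.ofReal_mul (by positivity)]
        congr 3
        field_simp

/-! ### The operator bound -/

theorem exists_schwartzMap_symbol_mul {κ : ℝ} (hκ : 0 < κ) {b : ℂ} (hb : b = I ∨ b = -I)
    (f : 𝓢(ℝ, ℂ)) :
    ∃ g : 𝓢(ℝ, ℂ), ∀ ξ, g ξ = ((κ : ℂ) + b * ξ) ^ (-(1 / 2 : ℂ)) * f ξ := by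
  have hb0 : b.re = 0 := by rcases hb with rfl | rfl <;> simp
  have h := hasTemperateGrowth_affine_cpow hκ hb0 (r := -(1 / 2)) (by norm_num)
  refine ⟨SchwartzMap.smulLeftCLM ℂ
    (fun ξ : ℝ => ((κ : ℂ) + b * ξ) ^ ((-(1 / 2) : ℝ) : ℂ)) f, fun ξ => ?_⟩
  rw [SchwartzMap.smulLeftCLM_apply_apply h, smul_eq_mul]
  push_cast
  rfl

theorem exists_schwartzMap_Lam {κ : ℝ} (hκ : 0 < κ) (q u : 𝓢(ℝ, ℂ)) :
    ∃ L : 𝓢(ℝ, ℂ), ⇑L = Lam κ q u ∧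
      ∫⁻ x, ‖L x‖ₑ ^ 2 ≤ ∫⁻ ξ, (symbolNorm κ ξ *
        ∫⁻ η, ‖fhat q (ξ - η)‖ₑ * (symbolNorm κ η * ‖fhat u η‖ₑ)) ^ 2 := by
  obtain ⟨u', hu', -⟩ := exists_schwartzMap_fhat u
  obtain ⟨h, hh⟩ := exists_schwartzMap_symbol_mul hκ (Or.inl rfl) u'
  obtain ⟨m, hm, -⟩ := exists_schwartzMap_finv h
  have hmp : Mplus κ u = finv h := by
    rw [Mplus]; congr 1; ext ξ; rw [hh, hu']
  obtain ⟨p, hp, -⟩ := exists_schwartzMap_fhat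
    (SchwartzMap.smulLeftCLM ℂ (⇑q) m)
  rw [SchwartzMap.smulLeftCLM_apply q.hasTemperateGrowth] at hp
  obtain ⟨g, hg⟩ := exists_schwartzMap_symbol_mul hκ (Or.inr rfl) p
  obtain ⟨L, hL, hLg⟩ := exists_schwartzMap_finv g
  refine ⟨L, ?_, ?_⟩
  · rw [hL, Lam, Mminus]
    congr 1
    ext ξ
    rw [hg, hp, hmp, ← hm]
    simp only [smul_eq_mul, neg_mul, ← sub_eq_add_neg]
  · rw [SchwartzMap.lintegral_enorm_sq, hLg, ← SchwartzMap.lintegral_enorm_sq]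
    refine lintegral_mono fun ξ => ?_
    rw [hg, enorm_mul, enorm_symbol κ ξ (Or.inr rfl), hp]
    simp only [smul_eq_mul]
    rw [hm, fhat_mul_finv q.integrable h.integrable, enorm_mul]
    gcongr
    have hc : ‖((Real.sqrt (2 * Real.pi) : ℂ))⁻¹‖ₑ ≤ 1 := by
      rw [← ofReal_norm, norm_inv, Complex.norm_real, Real.norm_of_nonneg (by positivity)]
      refine ENNReal.ofReal_le_one.2 (inv_le_one_of_one_le₀ (Real.one_le_sqrt.2 ?_))
      nlinarith [Real.pi_gt_three]
    calc _ ≤ 1 * ∫⁻ η, ‖h η * fhat q (ξ - η)‖ₑ := by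
          gcongr
          exact enorm_integral_le_lintegral_enorm _
      _ = _ := by
          rw [one_mul]
          refine lintegral_congr fun η => ?_
          rw [enorm_mul, hh, enorm_mul, enorm_symbol κ η (Or.inl rfl), hu', mul_comm]

theorem equiWeight_sq_le_one {σ : ℝ} (hσ : 0 < σ) {κ : ℝ} (hκ : 0 < κ) (ζ : ℝ) :
    equiWeight σ κ ζ ^ 2 ≤ 1 := by
  have hp : 0 < (4 * κ ^ 2 + ζ ^ 2) ^ σ := by positivity
  rw [equiWeight_sq, Real.rpow_neg (by positivity), ← div_eq_mul_inv, div_le_one hp,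
    Real.rpow_mul (abs_nonneg _), Real.rpow_two, sq_abs]
  exact Real.rpow_le_rpow (by positivity) (by nlinarith [sq_nonneg κ]) hσ.le

theorem lintegral_equiWeight_mul_fhat {σ : ℝ} (hσ : 0 < σ) {κ : ℝ} (hκ : 0 < κ) (q : 𝓢(ℝ, ℂ)) :
    ∫⁻ ζ, (ENNReal.ofReal (equiWeight σ κ ζ) * ‖fhat q ζ‖ₑ) ^ 2 = ENNReal.ofReal
      (∫ ξ : ℝ, |ξ| ^ (2 * σ) * (4 * κ ^ 2 + ξ ^ 2) ^ (-σ) * ‖fhat q ξ‖ ^ 2) := by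
  obtain ⟨q', hq', -⟩ := exists_schwartzMap_fhat q
  simp_rw [← hq', ← equiWeight_sq]
  rw [ofReal_integral_eq_lintegral_ofReal]
  · refine lintegral_congr fun ζ => ?_
    rw [← ofReal_norm, ← ENNReal.ofReal_mul (equiWeight_nonneg _ _ _),
      ← ENNReal.ofReal_pow (mul_nonneg (equiWeight_nonneg _ _ _) (norm_nonneg _)), mul_pow]
  · refine ((memLp_two_iff_integrable_sq_norm q'.continuous.aestronglyMeasurable).1
      (q'.memLp 2)).bdd_mul (c := 1) (Measurable.aestronglyMeasurable (by fun_prop))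
      (Filter.Eventually.of_forall fun ζ => ?_)
    rw [Real.norm_of_nonneg (by positivity)]
    exact equiWeight_sq_le_one hσ hκ ζ
  · exact Filter.Eventually.of_forall fun x => by positivity

theorem exists_Lam_bound {σ : ℝ} (hσ : 0 < σ) (hσ' : σ < 1 / 2) :
    ∃ C : ℝ, 0 < C ∧ ∀ κ : ℝ, 0 < κ → ∀ q u : 𝓢(ℝ, ℂ),
      Real.sqrt κ * Real.sqrt (∫ x : ℝ, ‖Lam κ q u x‖ ^ 2)
        ≤ C * Real.sqrt
            (∫ ξ : ℝ, |ξ| ^ (2 * σ) * (4 * κ ^ 2 + ξ ^ 2) ^ (-σ) * ‖fhat q ξ‖ ^ 2)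
          * Real.sqrt (∫ x : ℝ, ‖u x‖ ^ 2) := by
  obtain ⟨C, hC, h⟩ := exists_lintegral_kernel_le hσ hσ'
  refine ⟨Real.sqrt C, Real.sqrt_pos.2 hC, fun κ hκ q u => ?_⟩
  obtain ⟨q', hq', -⟩ := exists_schwartzMap_fhat q
  obtain ⟨u', hu', hun⟩ := exists_schwartzMap_fhat u
  obtain ⟨L, hL, hLle⟩ := exists_schwartzMap_Lam hκ q u
  have hE : 0 ≤ ∫ ξ : ℝ, |ξ| ^ (2 * σ) * (4 * κ ^ 2 + ξ ^ 2) ^ (-σ) * ‖fhat q ξ‖ ^ 2 :=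
    integral_nonneg fun ξ => by positivity
  have hN : 0 ≤ ∫ x : ℝ, ‖u x‖ ^ 2 := integral_nonneg fun ξ => by positivity
  have hker := h κ hκ (fun ζ => ‖fhat q ζ‖ₑ) (fun η => ‖fhat u η‖ₑ)
    (by rw [← hq']; exact q'.continuous.enorm.measurable)
    (by rw [← hu']; exact u'.continuous.enorm.measurable)
  rw [lintegral_equiWeight_mul_fhat hσ hκ, ← hu', SchwartzMap.lintegral_enorm_sq, hun,
    ← ENNReal.ofReal_mul hC.le, ← ENNReal.ofReal_mul (mul_nonneg hC.le hE), hu'] at hker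
  have hfin := (mul_le_mul_right hLle (ENNReal.ofReal κ)).trans hker
  rw [SchwartzMap.lintegral_enorm_sq, ← ENNReal.ofReal_mul hκ.le,
    ENNReal.ofReal_le_ofReal_iff (mul_nonneg (mul_nonneg hC.le hE) hN), hL] at hfin
  rw [← Real.sqrt_mul hκ.le, ← Real.sqrt_mul hC.le, ← Real.sqrt_mul (mul_nonneg hC.le hE)]
  exact Real.sqrt_le_sqrt hfin

/-! ### Equicontinuity controls high frequencies -/

theorem fhat_translate_sub {f : ℝ → ℂ} (hf : Integrable f) (y ξ : ℝ) :
    fhat (fun x => f (x + y) - f x) ξ = (exp (I * (ξ * y : ℝ)) - 1) * fhat f ξ := by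
  have hexp {g : ℝ → ℂ} (hg : Integrable g) (η : ℝ) :
      Integrable fun x : ℝ => exp (-(I * η * x)) * g x := by
    refine hg.bdd_mul (c := 1) (by fun_prop) (Filter.Eventually.of_forall fun x => ?_)
    rw [Complex.norm_exp]
    simp
  simp only [fhat, mul_sub]
  rw [integral_sub (hexp (hf.comp_add_right y) ξ) (hexp hf ξ),
    ← integral_add_right_eq_self (fun x : ℝ => exp (-(I * ξ * x)) * f x) y]
  have : ∀ x : ℝ, exp (-(I * ξ * x)) * f (x + y) =
      exp (I * (ξ * y : ℝ)) * (exp (-(I * ξ * (x + y : ℝ))) * f (x + y)) := fun x => by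
    rw [← mul_assoc, ← Complex.exp_add]
    congr 2
    push_cast
    ring
  simp_rw [this]
  rw [integral_const_mul]
  ring

theorem lintegral_translate_sub (q : 𝓢(ℝ, ℂ)) (y : ℝ) :
    ∫⁻ ξ : ℝ, ‖exp (I * (ξ * y : ℝ)) - 1‖ₑ ^ 2 * ‖fhat q ξ‖ₑ ^ 2 =
      ENNReal.ofReal (∫ x, ‖q (x + y) - q x‖ ^ 2) := by
  let d : 𝓢(ℝ, ℂ) := SchwartzMap.compSubConstCLM ℂ (-y) q - q
  have hd : ⇑d = fun x => q (x + y) - q x := by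
    ext x; simp [d]
  obtain ⟨g, hg, hn⟩ := exists_schwartzMap_fhat d
  have := SchwartzMap.lintegral_enorm_sq g
  rw [hn, hg, hd] at this
  rw [← this]
  refine lintegral_congr fun ξ => ?_
  rw [fhat_translate_sub q.integrable, enorm_mul, mul_pow]

theorem enorm_exp_sub_one_sq (θ : ℝ) :
    ‖exp (I * θ) - 1‖ₑ ^ 2 = ENNReal.ofReal (2 - 2 * Real.cos θ) := by
  rw [← ofReal_norm, ← ENNReal.ofReal_pow (norm_nonneg _), Complex.norm_exp_I_mul_ofReal_sub_one,
    Real.norm_eq_abs, sq_abs, mul_pow, Real.sin_sq_eq_half_sub]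
  congr 1
  rw [mul_div_cancel₀ θ two_ne_zero]
  ring

theorem le_lintegral_exp_sub_one_sq {δ ξ : ℝ} (hδ : 0 < δ) (hξ : 2 / δ ≤ |ξ|) :
    ENNReal.ofReal δ ≤ ∫⁻ y in Set.Ioc 0 δ, ‖exp (I * (ξ * y : ℝ)) - 1‖ₑ ^ 2 := by
  have h0 : 0 < |ξ| := lt_of_lt_of_le (by positivity) hξ
  have hξ0 : ξ ≠ 0 := abs_pos.1 h0
  simp_rw [enorm_exp_sub_one_sq]
  rw [← ofReal_integral_eq_lintegral_ofReal
    (((by fun_prop : Continuous fun y : ℝ => 2 - 2 * Real.cos (ξ * y)).integrableOn_Icc).mono_set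
      Set.Ioc_subset_Icc_self)
    (Filter.Eventually.of_forall fun y => by simpa using Real.cos_le_one (ξ * y)),
    ← intervalIntegral.integral_of_le hδ.le]
  refine ENNReal.ofReal_le_ofReal ?_
  rw [intervalIntegral.integral_sub (by simp) (Continuous.intervalIntegrable (by fun_prop) _ _),
    intervalIntegral.integral_const_mul, intervalIntegral.integral_comp_mul_left _ hξ0]
  simp only [intervalIntegral.integral_const, integral_cos, smul_eq_mul, mul_zero, Real.sin_zero,
    sub_zero]
  have h1 : ξ⁻¹ * Real.sin (ξ * δ) ≤ δ / 2 := by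
    calc ξ⁻¹ * Real.sin (ξ * δ) ≤ |ξ⁻¹ * Real.sin (ξ * δ)| := le_abs_self _
      _ ≤ |ξ|⁻¹ * 1 := by rw [abs_mul, abs_inv]; gcongr; exact Real.abs_sin_le_one _
      _ ≤ (2 / δ)⁻¹ := by rw [mul_one]; gcongr
      _ = δ / 2 := by rw [inv_div]
  linarith

theorem setLIntegral_fhat_sq_le (q : 𝓢(ℝ, ℂ)) {δ ε : ℝ} (hδ : 0 < δ)
    (h : ∀ y : ℝ, |y| ≤ δ → ∫ x, ‖q (x + y) - q x‖ ^ 2 ≤ ε) :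
    ∫⁻ ξ in {ξ : ℝ | 2 / δ ≤ |ξ|}, ‖fhat q ξ‖ₑ ^ 2 ≤ ENNReal.ofReal ε := by
  obtain ⟨q', hq', -⟩ := exists_schwartzMap_fhat q
  have hm : Measurable fun ξ => ‖fhat q ξ‖ₑ := by
    rw [← hq']; exact q'.continuous.enorm.measurable
  have hs : MeasurableSet {ξ : ℝ | 2 / δ ≤ |ξ|} :=
    measurableSet_le measurable_const (by fun_prop)
  have hm2 : Measurable fun p : ℝ × ℝ =>
      ‖exp (I * (p.1 * p.2 : ℝ)) - 1‖ₑ ^ 2 * ‖fhat q p.1‖ₑ ^ 2 :=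
    (Continuous.measurable (by fun_prop)).mul ((hm.comp measurable_fst).pow_const 2)
  have hδ' : ENNReal.ofReal δ ≠ 0 := by simpa using hδ
  rw [← ENNReal.mul_le_mul_iff_right hδ' ENNReal.ofReal_ne_top]
  calc _ = ∫⁻ ξ in {ξ : ℝ | 2 / δ ≤ |ξ|}, ENNReal.ofReal δ * ‖fhat q ξ‖ₑ ^ 2 :=
        (lintegral_const_mul _ (by fun_prop)).symm
    _ ≤ ∫⁻ ξ in {ξ : ℝ | 2 / δ ≤ |ξ|},
          (∫⁻ y in Set.Ioc 0 δ, ‖exp (I * (ξ * y : ℝ)) - 1‖ₑ ^ 2) * ‖fhat q ξ‖ₑ ^ 2 := by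
        refine setLIntegral_mono' hs fun ξ hξ => ?_
        gcongr
        exact le_lintegral_exp_sub_one_sq hδ hξ
    _ ≤ ∫⁻ ξ, (∫⁻ y in Set.Ioc 0 δ, ‖exp (I * (ξ * y : ℝ)) - 1‖ₑ ^ 2) * ‖fhat q ξ‖ₑ ^ 2 :=
        setLIntegral_le_lintegral _ _
    _ = ∫⁻ ξ, ∫⁻ y in Set.Ioc 0 δ, ‖exp (I * (ξ * y : ℝ)) - 1‖ₑ ^ 2 * ‖fhat q ξ‖ₑ ^ 2 := by
        refine lintegral_congr fun ξ => ?_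
        rw [lintegral_mul_const _ (by fun_prop)]
    _ = ∫⁻ y in Set.Ioc 0 δ, ∫⁻ ξ, ‖exp (I * (ξ * y : ℝ)) - 1‖ₑ ^ 2 * ‖fhat q ξ‖ₑ ^ 2 :=
        lintegral_lintegral_swap hm2.aemeasurable
    _ ≤ ∫⁻ _ in Set.Ioc 0 δ, ENNReal.ofReal ε := by
        refine setLIntegral_mono' measurableSet_Ioc fun y hy => ?_
        rw [lintegral_translate_sub]
        exact ENNReal.ofReal_le_ofReal (h y (by rw [abs_of_pos hy.1]; exact hy.2))
    _ = _ := by simp [mul_comm]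

theorem equiWeight_sq_le {σ : ℝ} (hσ : 0 < σ) {κ N ζ : ℝ} (hκ : 0 < κ) (h : |ζ| ≤ N) :
    equiWeight σ κ ζ ^ 2 ≤ (N / (2 * κ)) ^ (2 * σ) := by
  have hN : 0 ≤ N := (abs_nonneg ζ).trans h
  rw [equiWeight_sq, Real.div_rpow hN (by positivity), div_eq_mul_inv,
    ← Real.rpow_neg (by positivity : 0 ≤ 2 * κ)]
  gcongr
  calc (4 * κ ^ 2 + ζ ^ 2) ^ (-σ) ≤ ((2 * κ) ^ (2 : ℝ)) ^ (-σ) := by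
        refine Real.rpow_le_rpow_of_nonpos (by positivity) ?_ (by linarith)
        rw [Real.rpow_two]
        nlinarith [sq_nonneg ζ]
    _ = _ := by rw [← Real.rpow_mul (by positivity)]; congr 1; ring

theorem equiNorm_sq_le {σ : ℝ} (hσ : 0 < σ) {κ : ℝ} (hκ : 0 < κ) (q : 𝓢(ℝ, ℂ)) {δ ε : ℝ}
    (hδ : 0 < δ) (hε : 0 ≤ ε) (h : ∀ y : ℝ, |y| ≤ δ → ∫ x, ‖q (x + y) - q x‖ ^ 2 ≤ ε) :
    ∫ ξ : ℝ, |ξ| ^ (2 * σ) * (4 * κ ^ 2 + ξ ^ 2) ^ (-σ) * ‖fhat q ξ‖ ^ 2 ≤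
      (δ⁻¹ / κ) ^ (2 * σ) * (∫ x, ‖q x‖ ^ 2) + ε := by
  obtain ⟨q', hq', hn⟩ := exists_schwartzMap_fhat q
  have hs : MeasurableSet {ξ : ℝ | 2 / δ ≤ |ξ|} :=
    measurableSet_le measurable_const (by fun_prop)
  have hm : Measurable fun ξ => ‖fhat q ξ‖ₑ := by
    rw [← hq']; exact q'.continuous.enorm.measurable
  have hM : 0 ≤ ∫ x, ‖q x‖ ^ 2 := integral_nonneg fun x => by positivity
  rw [← ENNReal.ofReal_le_ofReal_iff (by positivity), ← lintegral_equiWeight_mul_fhat hσ hκ,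
    ← lintegral_add_compl _ hs, add_comm, ENNReal.ofReal_add (by positivity) hε]
  have hsq (ζ : ℝ) : (ENNReal.ofReal (equiWeight σ κ ζ) * ‖fhat q ζ‖ₑ) ^ 2 =
      ENNReal.ofReal (equiWeight σ κ ζ ^ 2) * ‖fhat q ζ‖ₑ ^ 2 := by
    rw [mul_pow, ENNReal.ofReal_pow (equiWeight_nonneg _ _ _)]
  refine add_le_add ?_ (le_trans ?_ (setLIntegral_fhat_sq_le q hδ h))
  · rw [ENNReal.ofReal_mul (by positivity), ← hn, ← SchwartzMap.lintegral_enorm_sq, hq',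
      ← lintegral_const_mul _ (by fun_prop)]
    refine (setLIntegral_mono' hs.compl fun ζ hζ => ?_).trans (setLIntegral_le_lintegral _ _)
    rw [hsq]
    gcongr
    have := equiWeight_sq_le hσ hκ (not_le.1 (Set.notMem_ofPred_iff.1 hζ)).le
    rwa [show 2 / δ / (2 * κ) = δ⁻¹ / κ by field_simp] at this
  · refine lintegral_mono fun ζ => ?_
    rw [hsq]
    exact mul_le_of_le_one_left' (ENNReal.ofReal_le_one.2 (equiWeight_sq_le_one hσ hκ ζ))

end

/-- **Operator bound for `Λ` via the equicontinuity norm.** For `0 < σ < 1/2`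
there is `C` with `√κ ‖Λ(κ;q)u‖_{L²} ≤ C ‖q‖_{E^σ_{σ,κ}} ‖u‖_{L²}` for all
`κ ≥ 1` and Schwartz `q, u`.  In particular, on any `L²`-bounded and
equicontinuous set `Q` of Schwartz functions, `√κ ‖Λ(κ;q)‖_{op} → 0` as
`κ → ∞`, uniformly for `q ∈ Q`. -/
theorem stmt_18 (σ : ℝ) (hσ : 0 < σ) (hσ' : σ < 1 / 2) :
    (∃ C : ℝ, 0 < C ∧
      ∀ κ : ℝ, 1 ≤ κ → ∀ q u : SchwartzMap ℝ ℂ,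
        Real.sqrt κ * Real.sqrt (∫ x : ℝ, ‖Lam κ (⇑q) (⇑u) x‖ ^ 2)
          ≤ C * Real.sqrt
              (∫ ξ : ℝ, |ξ| ^ (2 * σ) * (4 * κ ^ 2 + ξ ^ 2) ^ (-σ) * ‖fhat (⇑q) ξ‖ ^ 2)
            * Real.sqrt (∫ x : ℝ, ‖u x‖ ^ 2)) ∧
    (∀ Q : Set (SchwartzMap ℝ ℂ),
      (∃ M : ℝ, ∀ q ∈ Q, (∫ x : ℝ, ‖q x‖ ^ 2) ≤ M) →
      (∀ ε : ℝ, 0 < ε → ∃ δ : ℝ, 0 < δ ∧ ∀ q ∈ Q, ∀ y : ℝ, |y| < δ →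
        Real.sqrt (∫ x : ℝ, ‖q (x + y) - q x‖ ^ 2) < ε) →
      ∀ ε : ℝ, 0 < ε → ∃ κ₀ : ℝ, ∀ κ : ℝ, κ₀ ≤ κ → ∀ q ∈ Q,
        ∀ u : SchwartzMap ℝ ℂ,
          Real.sqrt κ * Real.sqrt (∫ x : ℝ, ‖Lam κ (⇑q) (⇑u) x‖ ^ 2)
            ≤ ε * Real.sqrt (∫ x : ℝ, ‖u x‖ ^ 2)) := by
  obtain ⟨C, hC, hbound⟩ := exists_Lam_bound hσ hσ'
  refine ⟨⟨C, hC, fun κ hκ => hbound κ (by linarith)⟩, ?_⟩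
  rintro Q ⟨M, hM⟩ hQ ε hε
  have hη : 0 < (ε / C) ^ 2 / 2 := by positivity
  obtain ⟨δ, hδ, hδQ⟩ := hQ _ (Real.sqrt_pos.2 hη)
  have hlim : Filter.Tendsto (fun κ : ℝ => ((δ / 2)⁻¹ / κ) ^ (2 * σ) * M) Filter.atTop
      (nhds 0) := by
    have h := (Filter.Tendsto.const_div_atTop (g := fun κ : ℝ => κ) Filter.tendsto_id
      (δ / 2)⁻¹).rpow_const (p := 2 * σ) (Or.inr (by positivity))
    simpa [Real.zero_rpow (by positivity : 2 * σ ≠ 0)] using h.mul_const M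
  obtain ⟨κ₀, hκ₀⟩ := Filter.eventually_atTop.1
    ((hlim.eventually (gt_mem_nhds hη)).and (Filter.eventually_gt_atTop 0))
  refine ⟨κ₀, fun κ hκ q hq u => ?_⟩
  obtain ⟨hsmall, hκ0⟩ := hκ₀ κ hκ
  refine (hbound κ hκ0 q u).trans ?_
  gcongr
  rw [← le_div_iff₀' hC]
  refine Real.sqrt_le_iff.2 ⟨by positivity, ?_⟩
  have h := equiNorm_sq_le hσ hκ0 q (half_pos hδ) hη.le fun y hy =>
    ((Real.sqrt_lt_sqrt_iff (integral_nonneg fun x => by positivity)).1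
      (hδQ q hq y (by linarith))).le
  have hpow : ((δ / 2)⁻¹ / κ) ^ (2 * σ) * (∫ x, ‖q x‖ ^ 2) ≤ ((δ / 2)⁻¹ / κ) ^ (2 * σ) * M := by
    gcongr
    exact hM q hq
  linarith
end
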